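/- (Metaclass VII obstruction.) Let K be the real 6×6 block matrix [[D₁, D₂],[D₂, D₁]], where D₁ = diag(α₁,α₂,α₃) and D₂ = diag(α₄,α₅,α₆) for arbitrary reals α₁,…,α₆ (the Metaclass VII normal form), regarded as a medium tensor κ on ℝ⁴ via the index-pair basis. Then there exist no μ ∈ ℝ, λ > 0, ρ ∈ ℝ and bivectors A, B such that (κ + μ·Id)∘(κ + μ·Id) = −λ·Id + ρ(Ā⊗B) + ρ(B̄⊗A). Consequently no medium tensor of Metaclass VII satisfies the double-light-cone characterisation condition. -/

import Mathlib

noncomputable section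
open Matrix BigOperators

/-- Medium tensor components `κ^{ij}_{rs}` on ℝ⁴ (upper indices first). -/
abbrev MT := Fin 4 → Fin 4 → Fin 4 → Fin 4 → ℝ

/-- Bivector (or 2-form) components on ℝ⁴. -/
abbrev BV := Fin 4 → Fin 4 → ℝ

/-- Totally antisymmetric Levi-Civita symbol on {0,1,2,3} with ε₀₁₂₃ = 1. -/
def eps (i j k l : Fin 4) : ℝ :=
  ((j.val : ℝ) - i.val) * ((k.val : ℝ) - i.val) * ((l.val : ℝ) - i.val) *
    ((k.val : ℝ) - j.val) * ((l.val : ℝ) - j.val) * ((l.val : ℝ) - k.val) / 12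

/-- Identity medium tensor `Id^{ij}_{rs} = δ^i_r δ^j_s − δ^i_s δ^j_r`. -/
def idT : MT := fun i j r s =>
  (if i = r then (1 : ℝ) else 0) * (if j = s then 1 else 0) -
    (if i = s then 1 else 0) * (if j = r then 1 else 0)

/-- Composition `(κ∘η)^{ij}_{rs} = (1/2) κ^{ab}_{rs} η^{ij}_{ab}`. -/
def compT (κ η : MT) : MT := fun i j r s => (1 / 2) * ∑ a, ∑ b, κ a b r s * η i j a b

/-- Poincaré adjoint `κ̄^{ij}_{rs} = (1/4) ε_{rsab} κ^{ab}_{cd} ε^{cdij}`. -/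
def adjT (κ : MT) : MT := fun i j r s =>
  (1 / 4) * ∑ a, ∑ b, ∑ c, ∑ d, eps r s a b * κ a b c d * eps c d i j

/-- Trace `tr κ = (1/2) κ^{ij}_{ij}`. -/
def traceT (κ : MT) : ℝ := (1 / 2) * ∑ i, ∑ j, κ i j i j

def antisymBV (A : BV) : Prop := ∀ i j, A i j = - A j i

def antisymMT (κ : MT) : Prop :=
  (∀ i j r s, κ i j r s = - κ j i r s) ∧ (∀ i j r s, κ i j r s = - κ i j s r)

/-- The medium tensor `(ρ Ā⊗B)^{ij}_{rs} = ρ ε_{rsab} A^{ab} B^{ij}`. -/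
def tensAB (ρ : ℝ) (A B : BV) : MT := fun i j r s =>
  ρ * (∑ a, ∑ b, eps r s a b * A a b) * B i j

/-- Hodge star `(∗_g)^{ij}_{rs} = √|det g| g^{ia} g^{jb} ε_{abrs}`. -/
def hodge (g : Matrix (Fin 4) (Fin 4) ℝ) : MT := fun i j r s =>
  Real.sqrt |g.det| * ∑ a, ∑ b, g⁻¹ i a * g⁻¹ j b * eps a b r s

/-- The (non-symmetrised) Fresnel tensor density `𝒢₀^{ijkl}`. -/
def G0 (κ : MT) (i j k l : Fin 4) : ℝ :=
  (1 / 48) * ∑ a₁, ∑ a₂, ∑ a₃, ∑ a₄, ∑ b₁, ∑ b₂, ∑ b₃, ∑ b₄, ∑ b₅, ∑ b₆,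
    κ a₁ a₂ b₁ b₂ * κ a₃ i b₃ b₄ * κ a₄ j b₅ b₆ *
      eps b₁ b₂ b₅ k * eps b₃ b₄ b₆ l * eps a₁ a₂ a₃ a₄

/-- Fresnel polynomial `G(ξ) = 𝒢₀^{ijkl} ξ_i ξ_j ξ_k ξ_l`. -/
def fresnel (κ : MT) (ξ : Fin 4 → ℝ) : ℝ :=
  ∑ i, ∑ j, ∑ k, ∑ l, G0 κ i j k l * ξ i * ξ j * ξ k * ξ l

/-- A Lorentz metric: real symmetric invertible 4×4 matrix of signature
(−+++) or (+−−−), equivalently symmetric with negative determinant. -/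
def IsLorentz (g : Matrix (Fin 4) (Fin 4) ℝ) : Prop := g.IsSymm ∧ g.det < 0

/-- Null cone `N(g) = {ξ : g^{ij} ξ_i ξ_j = 0}` (on covectors, via the inverse metric). -/
def nullCone (g : Matrix (Fin 4) (Fin 4) ℝ) : Set (Fin 4 → ℝ) :=
  {ξ | ∑ i, ∑ j, g⁻¹ i j * ξ i * ξ j = 0}

/-- The ordering O = (01, 02, 03, 23, 31, 12) of index pairs. -/
def pairs : Fin 6 → Fin 4 × Fin 4 := ![(0, 1), (0, 2), (0, 3), (2, 3), (3, 1), (1, 2)]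

/-- The 6×6 matrix representing a medium tensor: `M_{IJ} = κ^{J₁J₂}_{I₁I₂}`. -/
def mat6 (κ : MT) : Matrix (Fin 6) (Fin 6) ℝ := fun I J =>
  κ (pairs J).1 (pairs J).2 (pairs I).1 (pairs I).2

/-- The Fresnel surface decomposes into a double light cone. -/
def DoubleCone (κ : MT) : Prop :=
  ∃ gp gm, IsLorentz gp ∧ IsLorentz gm ∧ nullCone gp ≠ nullCone gm ∧
    {ξ | fresnel κ ξ = 0} = nullCone gp ∪ nullCone gm

/-- The basis 2-form (bivector) indexed by I ∈ O, as antisymmetric components. -/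
def bform (I : Fin 6) : BV := fun i j =>
  if (i, j) = pairs I then 1 else if (j, i) = pairs I then -1 else 0

/-- The medium tensor determined by a 6×6 matrix M (so that mat6 ∘ tensorOf = id). -/
def tensorOf (M : Matrix (Fin 6) (Fin 6) ℝ) : MT := fun i j r s =>
  ∑ I, ∑ J, M I J * bform J i j * bform I r s

lemma bform_antisymm (I : Fin 6) (i j : Fin 4) : bform I i j = -bform I j i := by
  fin_cases I <;> fin_cases i <;> fin_cases j <;> simp [bform, pairs]

lemma bform_pairs (I J : Fin 6) :
    bform I (pairs J).1 (pairs J).2 = if I = J then 1 else 0 := by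
  fin_cases I <;> fin_cases J <;> simp [bform, pairs]

lemma mat6_tensorOf (M : Matrix (Fin 6) (Fin 6) ℝ) : mat6 (tensorOf M) = M := by
  ext I J
  simp [mat6, tensorOf, bform_pairs]

lemma antisymMT_tensorOf (M : Matrix (Fin 6) (Fin 6) ℝ) : antisymMT (tensorOf M) := by
  constructor <;> intro i j r s <;> simp only [tensorOf, ← Finset.sum_neg_distrib] <;>
    refine Finset.sum_congr rfl fun I _ => Finset.sum_congr rfl fun J _ => ?_
  · rw [bform_antisymm J i j]; ring
  · rw [bform_antisymm I r s]; ring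

lemma mat6_idT : mat6 idT = 1 := by
  ext I J
  fin_cases I <;> fin_cases J <;> simp [mat6, idT, pairs]

lemma antisymMT_idT : antisymMT idT := by
  constructor <;> intro i j r s <;> simp only [idT] <;> ring

lemma antisymMT.add_smul {κ η : MT} (hκ : antisymMT κ) (hη : antisymMT η) (c : ℝ) :
    antisymMT (fun i j r s => κ i j r s + c * η i j r s) := by
  constructor <;> intro i j r s
  · linear_combination hκ.1 i j r s + c * hη.1 i j r s
  · linear_combination hκ.2 i j r s + c * hη.2 i j r s

/-- Composition of medium tensors is represented by multiplication of matrices. -/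
lemma mat6_compT {κ η : MT} (hκ : antisymMT κ) (hη : antisymMT η) :
    mat6 (compT κ η) = mat6 κ * mat6 η := by
  ext I J
  simp only [mat6, compT, Matrix.mul_apply]
  generalize (pairs I).1 = r, (pairs I).2 = s, (pairs J).1 = i, (pairs J).2 = j
  have hswap (a b : Fin 4) : κ a b r s * η i j a b = κ b a r s * η i j b a := by
    rw [hκ.1 a b, hη.2 i j a b]; ring
  have hdiag (a : Fin 4) : κ a a r s * η i j a a = 0 := by
    have : κ a a r s = 0 := by linarith [hκ.1 a a r s]
    rw [this, zero_mul]
  simp only [Fin.sum_univ_four, Fin.sum_univ_six, pairs, hdiag]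
  simp only [Matrix.cons_val]
  rw [hswap 1 0, hswap 2 0, hswap 3 0, hswap 2 1, hswap 3 2, hswap 1 3]
  ring

/-- The index of the pair complementary to a given one is obtained by adding `3`. -/
lemma mat6_tensAB (ρ : ℝ) {A : BV} (hA : antisymBV A) (B : BV) (I J : Fin 6) :
    mat6 (tensAB ρ A B) I J =
      2 * ρ * A (pairs (I + 3)).1 (pairs (I + 3)).2 * B (pairs J).1 (pairs J).2 := by
  have heps : ∑ a, ∑ b, eps (pairs I).1 (pairs I).2 a b * A a b =
      2 * A (pairs (I + 3)).1 (pairs (I + 3)).2 := by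
    have h10 := hA 1 0
    have h20 := hA 2 0
    have h30 := hA 3 0
    have h21 := hA 2 1
    have h32 := hA 3 2
    have h13 := hA 1 3
    fin_cases I <;> simp [pairs, eps, Fin.sum_univ_four] <;> norm_num <;> linarith
  simp only [mat6, tensAB, heps]
  ring

lemma det_vecMulVec_add_vecMulVec_eq_zero (x y a b : Fin 3 → ℝ) :
    (vecMulVec x b + vecMulVec y a).det = 0 := by
  simp only [det_fin_three, Matrix.add_apply, vecMulVec_apply]
  ring

/-- Metaclass VII obstruction: no medium tensor whose matrix is the
Metaclass VII normal form [[D₁,D₂],[D₂,D₁]], D₁ = diag(α₁,α₂,α₃),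
D₂ = diag(α₄,α₅,α₆), satisfies the double-light-cone characterisation
(κ + μ·Id)² = −λ·Id + ρ(Ā⊗B) + ρ(B̄⊗A) with λ > 0. -/
theorem stmt18 (α₁ α₂ α₃ α₄ α₅ α₆ : ℝ) :
    ¬ ∃ (μ lam ρ : ℝ) (A B : BV), 0 < lam ∧ antisymBV A ∧ antisymBV B ∧
      compT
          (fun i j r s => tensorOf
            !![α₁, 0, 0, α₄, 0, 0;
               0, α₂, 0, 0, α₅, 0;
               0, 0, α₃, 0, 0, α₆;
               α₄, 0, 0, α₁, 0, 0;
               0, α₅, 0, 0, α₂, 0;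
               0, 0, α₆, 0, 0, α₃] i j r s + μ * idT i j r s)
          (fun i j r s => tensorOf
            !![α₁, 0, 0, α₄, 0, 0;
               0, α₂, 0, 0, α₅, 0;
               0, 0, α₃, 0, 0, α₆;
               α₄, 0, 0, α₁, 0, 0;
               0, α₅, 0, 0, α₂, 0;
               0, 0, α₆, 0, 0, α₃] i j r s + μ * idT i j r s) =
        fun i j r s =>
          -lam * idT i j r s + tensAB ρ A B i j r s + tensAB ρ B A i j r s := by
  rintro ⟨μ, lam, ρ, A, B, hlam, hA, hB, h⟩
  have hκ := (antisymMT_tensorOf !![α₁, 0, 0, α₄, 0, 0;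
    0, α₂, 0, 0, α₅, 0;
    0, 0, α₃, 0, 0, α₆;
    α₄, 0, 0, α₁, 0, 0;
    0, α₅, 0, 0, α₂, 0;
    0, 0, α₆, 0, 0, α₃]).add_smul antisymMT_idT μ
  have hmat := congrArg mat6 h
  rw [mat6_compT hκ hκ] at hmat
  have mat6_add_smul (κ η : MT) (c : ℝ) :
      mat6 (fun i j r s => κ i j r s + c * η i j r s) = mat6 κ + c • mat6 η := rfl
  have mat6_rhs : mat6 (fun i j r s =>
      -lam * idT i j r s + tensAB ρ A B i j r s + tensAB ρ B A i j r s) =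
      -lam • mat6 idT + mat6 (tensAB ρ A B) + mat6 (tensAB ρ B A) := rfl
  rw [mat6_add_smul, mat6_rhs, mat6_tensorOf, mat6_idT] at hmat
  let e : Fin 3 → Fin 6 := Fin.castLE (by norm_num)
  have hminor : diagonal ![(α₁ + μ) ^ 2 + α₄ ^ 2 + lam, (α₂ + μ) ^ 2 + α₅ ^ 2 + lam,
        (α₃ + μ) ^ 2 + α₆ ^ 2 + lam] =
      vecMulVec (fun i => 2 * ρ * A (pairs (e i + 3)).1 (pairs (e i + 3)).2)
          (fun j => B (pairs (e j)).1 (pairs (e j)).2) +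
        vecMulVec (fun i => 2 * ρ * B (pairs (e i + 3)).1 (pairs (e i + 3)).2)
          (fun j => A (pairs (e j)).1 (pairs (e j)).2) := by
    ext i j
    have hij := congrFun (congrFun hmat (e i)) (e j)
    simp only [Matrix.add_apply, mat6_tensAB ρ hA, mat6_tensAB ρ hB] at hij
    simp only [Matrix.add_apply, vecMulVec_apply]
    rw [add_assoc, ← sub_eq_iff_eq_add'] at hij
    rw [← hij]
    fin_cases i <;> fin_cases j <;>
      simp [e, Matrix.mul_apply, Fin.sum_univ_six, Matrix.one_apply] <;> ring
  have hdet := congrArg Matrix.det hminor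
  rw [det_vecMulVec_add_vecMulVec_eq_zero, det_diagonal, Fin.prod_univ_three] at hdet
  simp only [Matrix.cons_val] at hdet
  exact absurd hdet (by positivity)
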